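/- arXiv:2101.07629 — 3 statements merged into one kernel-verified Lean document; each statement's English description precedes it below -/
import Mathlib

section
/- Let d̃ := ∑_{i ≠ s}(d_i − 1) + d_s − δ. Then dim_{F_q} D_X^{(δ,s)}(d̃) = (d_s − δ + 1)·∏_{i ≠ s} d_i. -/
namespace QACC

open MvPolynomial

noncomputable section

variable {F : Type} [Field F] [Fintype F] [DecidableEq F]

/-- The points of the cartesian set `X = K 0 × ⋯ × K (n-1)`, as a subtype. -/
abbrev cartPoint {n : ℕ} (K : Fin n → Set F) : Type _ :=
  {α : Fin n → F // ∀ i, α i ∈ K i}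

noncomputable instance {n : ℕ} (K : Fin n → Set F) : Fintype (cartPoint K) :=
  Fintype.ofFinite _

/-- The evaluation linear map `Ψ` sending a polynomial to its vector of values at points of X. -/
def evalX {n : ℕ} (K : Fin n → Set F) :
    MvPolynomial (Fin n) F →ₗ[F] (cartPoint K → F) where
  toFun f := fun x => eval x.1 f
  map_add' f g := by funext x; simp
  map_smul' c f := by funext x; simp

/-- The affine cartesian code `C_X(d)`: evaluations of polynomials of total degree `≤ d`. -/
def cartCode {n : ℕ} (K : Fin n → Set F) (d : ℕ) : Submodule F (cartPoint K → F) :=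
  (restrictTotalDegree (Fin n) F d).map (evalX K)

/-- The space `P_d^{(δ,s)}` of polynomials of total degree `≤ d` with degree in `X s`
at most `|K s| - δ`. -/
def quasiPoly (n : ℕ) (K : Fin n → Set F) (d δ : ℕ) (s : Fin n) :
    Submodule F (MvPolynomial (Fin n) F) where
  carrier := {f | f.totalDegree ≤ d ∧ f.degreeOf s ≤ (K s).ncard - δ}
  zero_mem' := by simp
  add_mem' := by
    rintro f g ⟨hf1, hf2⟩ ⟨hg1, hg2⟩
    exact ⟨le_trans (totalDegree_add f g) (max_le hf1 hg1),
      le_trans (degreeOf_add_le s f g) (max_le hf2 hg2)⟩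
  smul_mem' := by
    rintro c f ⟨hf1, hf2⟩
    refine ⟨le_trans (totalDegree_smul_le c f) hf1, ?_⟩
    calc (c • f).degreeOf s = (C c * f).degreeOf s := by rw [smul_eq_C_mul]
      _ ≤ (C c).degreeOf s + f.degreeOf s := degreeOf_mul_le s (C c) f
      _ ≤ (K s).ncard - δ := by simpa [degreeOf_C] using hf2

/-- The `(δ,s)`-quasi affine cartesian code `D_X^{(δ,s)}(d)`. -/
def quasiCode {n : ℕ} (K : Fin n → Set F) (d δ : ℕ) (s : Fin n) :
    Submodule F (cartPoint K → F) :=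
  (quasiPoly n K d δ s).map (evalX K)

/-- The minimum distance (minimum Hamming weight of a nonzero codeword) of a linear code. -/
def minDist {ι : Type} [Fintype ι] (C : Submodule F (ι → F)) : ℕ :=
  sInf {w | ∃ v ∈ C, v ≠ 0 ∧ hammingNorm v = w}


/-- Evaluation on `X` of the monomial with exponent vector `e`. -/
def monomialEval {n : ℕ} (K : Fin n → Set F) (e : Fin n → ℕ) : cartPoint K → F :=
  fun x => ∏ i, x.1 i ^ e i

theorem evalX_monomial {n : ℕ} (K : Fin n → Set F) (e : Fin n →₀ ℕ) (c : F) :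
    evalX K (monomial e c) = c • monomialEval K e := by
  funext x
  simp [evalX, monomialEval, eval_monomial, Finsupp.prod_fintype]

/-- The evaluations of monomials whose degree in each `X i` is less than `b i ≤ |K i|` are
linearly independent. -/
theorem linearIndependent_monomialEval {n : ℕ} (K : Fin n → Set F) (b : Fin n → ℕ)
    (hb : ∀ i, b i ≤ (K i).ncard) (hpos : ∀ i, 0 < (K i).ncard) :
    LinearIndependent F (fun e : (∀ i, Fin (b i)) => monomialEval K fun i => (e i : ℕ)) := by
  classical
  rw [Fintype.linearIndependent_iff]
  intro g hg
  have hinj : Function.Injective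
      (fun e : (∀ i, Fin (b i)) => Finsupp.equivFunOnFinite.symm fun i => (e i : ℕ)) := by
    intro e e' h
    funext i
    exact Fin.ext (DFunLike.congr_fun h i)
  set P : MvPolynomial (Fin n) F :=
    ∑ e : (∀ i, Fin (b i)), monomial (Finsupp.equivFunOnFinite.symm fun i => (e i : ℕ)) (g e)
    with hP
  have heval : evalX K P = 0 := by
    rw [← hg, hP, map_sum]
    exact Finset.sum_congr rfl fun e _ => evalX_monomial K _ _
  have hcoeff (e : ∀ i, Fin (b i)) :
      coeff (Finsupp.equivFunOnFinite.symm fun i => (e i : ℕ)) P = g e := by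
    rw [hP, coeff_sum, Finset.sum_eq_single e]
    · simp
    · intro e' _ hne
      rw [coeff_monomial, if_neg fun h => hne (hinj h)]
    · simp
  have hP0 : P = 0 := by
    refine eq_zero_of_eval_zero_at_prod_finset P (fun i => (K i).toFinite.toFinset) ?_ ?_
    · intro i
      rw [← Set.ncard_eq_toFinset_card]
      rw [degreeOf_lt_iff (hpos i)]
      intro m hm
      obtain ⟨e, -, he⟩ := Finset.mem_biUnion.1 (support_sum hm)
      rw [Finset.mem_singleton.1 (support_monomial_subset he)]
      exact (e i).2.trans_le (hb i)
    · intro x hx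
      exact congrFun heval ⟨x, fun i => by simpa using hx i⟩
  intro e
  rw [← hcoeff, hP0, coeff_zero]

/-- A power function on a finite set of `d` points agrees with a polynomial of degree less
than `d`. -/
theorem exists_sum_eq_pow_on (S : Set F) (k : ℕ) :
    ∃ c : ℕ → F, ∀ x ∈ S, x ^ k = ∑ j ∈ Finset.range S.ncard, c j * x ^ j := by
  classical
  refine ⟨(Lagrange.interpolate S.toFinite.toFinset id fun x => x ^ k).coeff, fun x hx => ?_⟩
  have hinj : Set.InjOn (id : F → F) (S.toFinite.toFinset : Set F) := Set.injOn_id _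
  have hx' : x ∈ S.toFinite.toFinset := by simpa using hx
  have h := Lagrange.eval_interpolate_at_node (fun x : F => x ^ k) hinj hx'
  have hdeg := Lagrange.degree_interpolate_lt (fun x : F => x ^ k) hinj
  rw [← Set.ncard_eq_toFinset_card] at hdeg
  rw [← Polynomial.eval_eq_sum_range' (p := Lagrange.interpolate _ id _)]
  · exact h.symm
  · by_cases h0 : Lagrange.interpolate S.toFinite.toFinset id (fun x => x ^ k) = 0
    · rw [h0, Polynomial.natDegree_zero, Set.ncard_pos]
      exact ⟨x, hx⟩
    · exact (Polynomial.natDegree_lt_iff_degree_lt h0).2 hdeg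

/-- Every monomial evaluation with exponent vector `e` is a combination of those with exponents
below `b`, provided `e i < b i` whenever `b i ≠ |K i|`. -/
theorem monomialEval_mem_span {n : ℕ} (K : Fin n → Set F) (b e : Fin n → ℕ)
    (h : ∀ i, b i = (K i).ncard ∨ e i < b i) :
    monomialEval K e ∈
      Submodule.span F (Set.range fun e : (∀ i, Fin (b i)) => monomialEval K fun i => (e i : ℕ)) := by
  classical
  have hex (i : Fin n) : ∃ c : ℕ → F, ∀ x ∈ K i, x ^ e i = ∑ j : Fin (b i), c j * x ^ (j : ℕ) := by
    rcases h i with hi | hi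
    · obtain ⟨c, hc⟩ := exists_sum_eq_pow_on (K i) (e i)
      refine ⟨c, fun x hx => ?_⟩
      rw [hc x hx, ← hi, Finset.sum_range]
    · refine ⟨fun j => if j = e i then 1 else 0, fun x _ => ?_⟩
      rw [Finset.sum_eq_single ⟨e i, hi⟩]
      · simp
      · intro j _ hj
        simp [show (j : ℕ) ≠ e i from fun h => hj (Fin.ext h)]
      · simp
  choose c hc using hex
  have : monomialEval K e = ∑ p : (∀ i, Fin (b i)),
      (∏ i, c i (p i)) • monomialEval K fun i => (p i : ℕ) := by
    funext x
    simp only [monomialEval, Finset.sum_apply, Pi.smul_apply, smul_eq_mul,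
      ← Finset.prod_mul_distrib]
    rw [Finset.prod_congr rfl fun i _ => hc i _ (x.2 i), Finset.prod_univ_sum,
      Fintype.piFinset_univ]
  rw [this]
  exact Submodule.sum_mem _ fun p _ =>
    Submodule.smul_mem _ _ (Submodule.subset_span ⟨p, rfl⟩)

/-- In total degree `d` large enough, the quasi affine cartesian code is spanned by the monomial
evaluations in a box of exponents. -/
theorem quasiCode_eq_span {n : ℕ} (K : Fin n → Set F) (d δ : ℕ) (s : Fin n) (b : Fin n → ℕ)
    (hbs : b s = (K s).ncard - δ + 1) (hb : ∀ i ≠ s, b i = (K i).ncard)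
    (hd : ∑ i, (b i - 1) ≤ d) :
    quasiCode K d δ s =
      Submodule.span F (Set.range fun e : (∀ i, Fin (b i)) => monomialEval K fun i => (e i : ℕ)) := by
  apply le_antisymm
  · rintro _ ⟨f, ⟨-, hf⟩, rfl⟩
    rw [f.as_sum, map_sum]
    refine Submodule.sum_mem _ fun m hm => ?_
    rw [evalX_monomial]
    refine Submodule.smul_mem _ _ (monomialEval_mem_span K b m fun i => ?_)
    by_cases hi : i = s
    · subst hi
      right
      have := (degreeOf_le_iff.1 hf) m hm
      omega
    · exact Or.inl (hb i hi)
  · rw [Submodule.span_le]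
    rintro _ ⟨e, rfl⟩
    refine ⟨monomial (Finsupp.equivFunOnFinite.symm fun i => (e i : ℕ)) 1, ⟨?_, ?_⟩, ?_⟩
    · rw [totalDegree_monomial _ one_ne_zero, Finsupp.sum_fintype _ _ fun _ => rfl]
      refine le_trans (Finset.sum_le_sum fun i _ => ?_) hd
      exact Nat.le_sub_one_of_lt (e i).2
    · rw [degreeOf_monomial_eq _ _ one_ne_zero]
      have := (e s).2
      change (e s : ℕ) ≤ _
      omega
    · rw [evalX_monomial, one_smul]
      rfl

/-- the dimension of D_X^{(δ,s)}(d̃) is (d_s - δ + 1) ∏_{i ≠ s} d_i. -/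
theorem dim_quasiCode_at_dtilde
    (n : ℕ) (K : Fin n → Set F) (hK : ∀ i, 2 ≤ (K i).ncard)
    (δ : ℕ) (hδ : 2 ≤ δ) (s : Fin n) (hr : δ ≤ (K s).ncard)
    (dt : ℕ) (hdt : dt = (∑ i ∈ Finset.univ.erase s, ((K i).ncard - 1)) + ((K s).ncard - δ)) :
    Module.finrank F ↥(quasiCode K dt δ s) =
      ((K s).ncard - δ + 1) * ∏ i ∈ Finset.univ.erase s, (K i).ncard := by
  classical
  set b : Fin n → ℕ := fun i => if i = s then (K s).ncard - δ + 1 else (K i).ncard with hb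
  have hbs : b s = (K s).ncard - δ + 1 := if_pos rfl
  have hbi : ∀ i ≠ s, b i = (K i).ncard := fun i hi => if_neg hi
  have hble : ∀ i, b i ≤ (K i).ncard := fun i => by
    by_cases hi : i = s
    · subst hi
      omega
    · exact (hbi i hi).le
  have hd : ∑ i, (b i - 1) ≤ dt := by
    rw [hdt, ← Finset.sum_erase_add _ _ (Finset.mem_univ s), hbs, Nat.add_sub_cancel]
    refine Nat.add_le_add_right (Finset.sum_le_sum fun i hi => ?_) _
    rw [hbi i (Finset.ne_of_mem_erase hi)]
  rw [quasiCode_eq_span K dt δ s b hbs hbi hd,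
    finrank_span_eq_card (linearIndependent_monomialEval K b hble fun i => two_pos.trans_le (hK i)), Fintype.card_pi,
    ← Finset.mul_prod_erase _ _ (Finset.mem_univ s), Fintype.card_fin, hbs]
  congr 1
  refine Finset.prod_congr rfl fun i hi => ?_
  rw [Fintype.card_fin, hbi i (Finset.ne_of_mem_erase hi)]

end
end QACC
end

section
/- Assume 2 ≤ d_1 ≤ d_2 ≤ ⋯ ≤ d_n and write d = ∑_{i=1}^k (d_i − 1) + ℓ with 0 ≤ k < n and 0 < ℓ ≤ d_{k+1} − 1. If k + 2 ≤ n and d_{k+2} ≤ d_s, then W^(1)(D_X^{(δ,s)}(d)) = W^(1)(C_X(d)) = (d_{k+1} − ℓ)·∏_{i=k+2}^n d_i. -/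
namespace QACC

open MvPolynomial

noncomputable section

variable {F : Type} [Field F] [Fintype F] [DecidableEq F]

/-- The least weight allowed by the footprint bound: for side lengths `a` and degree `D`, the
degree is spent greedily on the coordinates in increasing order. -/
def footprintBound : (n : ℕ) → (Fin n → ℕ) → ℕ → ℕ
  | 0, _, _ => 1
  | n + 1, a, D =>
    if D < a 0 then (a 0 - D) * ∏ i, Fin.tail a i
    else footprintBound n (Fin.tail a) (D - (a 0 - 1))

/-- Spending `c` on the first coordinate cannot beat the greedy choice. -/
theorem footprintBound_cons_le (n : ℕ) (a : Fin (n + 1) → ℕ) (ha : Monotone a) (c D : ℕ)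
    (hc : c < a 0) (hcD : c ≤ D) :
    footprintBound (n + 1) a D ≤ (a 0 - c) * footprintBound n (Fin.tail a) (D - c) := by
  induction n generalizing c D with
  | zero =>
    simp only [footprintBound]
    split_ifs
    · simp; omega
    · omega
  | succ n ih =>
    have h01 : a 0 ≤ a 1 := ha (Fin.zero_le _)
    have htail : Monotone (Fin.tail a) := fun i j h => ha (Fin.succ_le_succ_iff.2 h)
    have ht0 : Fin.tail a 0 = a 1 := rfl
    obtain ⟨E, rfl⟩ := Nat.exists_eq_add_of_le hcD
    rw [Nat.add_sub_cancel_left]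
    by_cases hE : E < a 1
    · rw [show footprintBound (n + 1) (Fin.tail a) E
          = (a 1 - E) * ∏ i, Fin.tail (Fin.tail a) i by
          rw [footprintBound, if_pos (by rwa [ht0]), ht0], ← mul_assoc]
      rw [footprintBound]
      split_ifs with hD
      · rw [Fin.prod_univ_succ, ht0, ← mul_assoc]
        refine Nat.mul_le_mul ?_ le_rfl
        obtain ⟨y, hy⟩ := Nat.exists_eq_add_of_lt hD
        obtain ⟨z, hz⟩ := Nat.exists_eq_add_of_lt hE
        rw [show a 0 - (c + E) = y + 1 by omega, show a 0 - c = y + 1 + E by omega,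
          show a 1 - E = z + 1 by omega, hz]
        nlinarith
      · rw [footprintBound, if_pos (by rw [ht0]; omega), ht0]
        refine Nat.mul_le_mul ?_ le_rfl
        obtain ⟨y, hy⟩ := Nat.exists_eq_add_of_lt hc
        obtain ⟨z, hz⟩ := Nat.exists_eq_add_of_lt hE
        rw [show a 0 - c = y + 1 by omega, show a 1 - E = z + 1 by omega]
        refine le_trans (b := y + z + 1) (by omega) (by nlinarith)
    · have key := ih (Fin.tail a) htail (a 1 - (a 0 - c)) (c + E - (a 0 - 1))
        (by rw [ht0]; omega) (by omega)
      rw [footprintBound, if_neg (by omega)]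
      refine key.trans_eq ?_
      have hR : footprintBound (n + 1) (Fin.tail a) E
          = footprintBound n (Fin.tail (Fin.tail a)) (E - (a 1 - 1)) := by
        rw [footprintBound, if_neg (by rwa [ht0]), ht0]
      rw [hR, ht0, show a 1 - (a 1 - (a 0 - c)) = a 0 - c by omega,
        show c + E - (a 0 - 1) - (a 1 - (a 0 - c)) = E - (a 1 - 1) by omega]

theorem footprintBound_eq (n : ℕ) (a : Fin n → ℕ) (ha : ∀ i, 2 ≤ a i) (k ℓ : ℕ) (hk : k < n)
    (hℓ1 : 0 < ℓ) (hℓ2 : ℓ ≤ a ⟨k, hk⟩ - 1) :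
    footprintBound n a
      ((∑ i ∈ Finset.univ.filter (fun i : Fin n => (i : ℕ) < k), (a i - 1)) + ℓ) =
      (a ⟨k, hk⟩ - ℓ) * ∏ i ∈ Finset.univ.filter (fun i : Fin n => k + 1 ≤ (i : ℕ)), a i := by
  induction n generalizing k with
  | zero => omega
  | succ n ih =>
    rw [footprintBound]
    simp only [Finset.sum_filter, Finset.prod_filter, Fin.sum_univ_succ, Fin.prod_univ_succ]
    cases k with
    | zero =>
      have := ha 0
      simp at hℓ2 ⊢
      rw [if_pos (by omega)]
      rfl
    | succ k =>
      have := ha 0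
      have h := ih (Fin.tail a) (fun i => ha _) k (by omega) hℓ2
      simp only [Finset.sum_filter, Finset.prod_filter] at h
      simp only [Fin.val_zero, Fin.val_succ, Nat.succ_pos, if_true, add_lt_add_iff_right,
        add_le_add_iff_right]
      rw [if_neg (by omega), add_assoc, Nat.add_sub_cancel_left]
      refine h.trans ?_
      simp [Fin.tail]

variable {R : Type*} [Field R]

/-- The footprint bound for the number of non-zeros of a reduced polynomial on a grid. -/
theorem footprintBound_le_card [DecidableEq R] (n : ℕ) (S : Fin n → Finset R) (hS : Monotone fun i => (S i).card)
    (f : MvPolynomial (Fin n) R) (hf : f ≠ 0) (hdeg : ∀ i, f.degreeOf i < (S i).card)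
    (D : ℕ) (hD : f.totalDegree ≤ D) :
    footprintBound n (fun i => (S i).card) D ≤
      ((Fintype.piFinset S).filter fun x => eval x f ≠ 0).card := by
  induction n generalizing D with
  | zero =>
    rw [footprintBound, Nat.one_le_iff_ne_zero, Finset.card_ne_zero]
    obtain ⟨c, rfl⟩ := C_surjective (Fin 0) f
    exact ⟨default, Finset.mem_filter.2 ⟨by simp, by simpa using hf⟩⟩
  | succ n ih =>
    set p := finSuccEquiv R n f with hp
    have hp0 : p ≠ 0 := EmbeddingLike.map_ne_zero_iff.2 hf
    have hlc : p.coeff p.natDegree ≠ 0 := by simpa using hp0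
    have hnat : p.natDegree = f.degreeOf 0 := natDegree_finSuccEquiv f
    have htot := totalDegree_coeff_finSuccEquiv_add_le f p.natDegree hlc
    set T := (Fintype.piFinset (Fin.tail S)).filter fun x => eval x (p.coeff p.natDegree) ≠ 0
      with hT
    have hIH := ih (Fin.tail S) (fun i j h => hS (Fin.succ_le_succ_iff.2 h)) _ hlc
      (fun i => (degreeOf_coeff_finSuccEquiv f i _).trans_lt (hdeg _)) (D - p.natDegree)
      (by rw [← hp] at htot; omega)
    refine (footprintBound_cons_le n _ hS p.natDegree D (hnat ▸ hdeg 0) (by omega)).trans ?_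
    refine (Nat.mul_le_mul_left _ hIH).trans ?_
    have hfib : ∀ x ∈ T, (S 0).card - p.natDegree ≤
        ((S 0).filter fun y => eval (Fin.cons y x : Fin (n + 1) → R) f ≠ 0).card := by
      intro x hx
      have hx0 : eval x (p.coeff p.natDegree) ≠ 0 := (Finset.mem_filter.1 hx).2
      have hq0 : p.map (eval x) ≠ 0 := fun h => hx0 <| by
        rw [← Polynomial.coeff_map, h, Polynomial.coeff_zero]
      have hroots : ((S 0).filter fun y => eval (Fin.cons y x : Fin (n + 1) → R) f = 0).card
          ≤ p.natDegree :=
        calc _ ≤ (p.map (eval x)).roots.toFinset.card := by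
              refine Finset.card_le_card fun y hy => ?_
              rw [Multiset.mem_toFinset, Polynomial.mem_roots hq0, Polynomial.IsRoot.def,
                ← eval_eq_eval_mv_eval']
              exact (Finset.mem_filter.1 hy).2
          _ ≤ (p.map (eval x)).natDegree :=
              (Multiset.toFinset_card_le _).trans (Polynomial.card_roots' _)
          _ ≤ p.natDegree := Polynomial.natDegree_map_le
      have hsplit := Finset.card_filter_add_card_filter_not (s := S 0)
        (fun y => eval (Fin.cons y x : Fin (n + 1) → R) f = 0)
      simp only [ne_eq]
      omega
    calc _ = ∑ _x ∈ T, ((S 0).card - p.natDegree) := by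
          rw [Finset.sum_const, smul_eq_mul, mul_comm]
      _ ≤ ∑ x ∈ T, ((S 0).filter fun y => eval (Fin.cons y x : Fin (n + 1) → R) f ≠ 0).card :=
          Finset.sum_le_sum hfib
      _ = (T.sigma fun x => (S 0).filter fun y =>
            eval (Fin.cons y x : Fin (n + 1) → R) f ≠ 0).card := (Finset.card_sigma _ _).symm
      _ ≤ _ := by
          refine Finset.card_le_card_of_injOn (fun z => Fin.cons z.2 z.1) ?_ ?_
          · rintro ⟨x, y⟩ hz
            simp only [Finset.coe_sigma, Set.mem_sigma_iff, hT, Finset.coe_filter,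
              Fintype.mem_piFinset, Set.mem_ofPred_eq] at hz ⊢
            exact ⟨Fin.cases hz.2.1 hz.1.1, hz.2.2⟩
          · rintro ⟨x, y⟩ - ⟨x', y'⟩ - h
            obtain ⟨rfl, rfl⟩ := Fin.cons_inj.1 h
            rfl

theorem totalDegree_aeval_X_le {σ : Type*} (i : σ) (p : Polynomial R) :
    (Polynomial.aeval (X i : MvPolynomial σ R) p).totalDegree ≤ p.natDegree := by
  rw [Polynomial.aeval_eq_sum_range]
  refine (totalDegree_finsetSum _ _).trans (Finset.sup_le fun j hj => ?_)
  refine (totalDegree_smul_le _ _).trans ?_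
  rw [totalDegree_X_pow]
  exact Nat.lt_succ_iff.1 (Finset.mem_range.1 hj)

theorem degreeOf_aeval_X_le {σ : Type*} [DecidableEq σ] (i j : σ) (p : Polynomial R) :
    (Polynomial.aeval (X i : MvPolynomial σ R) p).degreeOf j ≤ if j = i then p.natDegree else 0 := by
  rw [Polynomial.aeval_eq_sum_range]
  refine (degreeOf_sum_le _ _ _).trans (Finset.sup_le fun m hm => ?_)
  rw [smul_eq_C_mul]
  refine (degreeOf_C_mul_le _ _ _).trans ((degreeOf_pow_le _ _ _).trans ?_)
  rw [degreeOf_X]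
  split_ifs
  · simpa using Nat.lt_succ_iff.1 (Finset.mem_range.1 hm)
  · simp

theorem natDegree_prod_X_sub_C (A : Finset R) :
    (∏ a ∈ A, (Polynomial.X - Polynomial.C a)).natDegree = A.card := by
  rw [Polynomial.natDegree_prod_of_monic _ _ fun a _ => Polynomial.monic_X_sub_C a]
  simp

/-- Every polynomial function on a grid is given by a reduced polynomial whose total degree is
no larger. -/
theorem exists_reduced {σ : Type*} [Fintype σ] [DecidableEq σ] (S : σ → Finset R)
    (hS : ∀ i, (S i).Nonempty) (f : MvPolynomial σ R) :
    ∃ g : MvPolynomial σ R, g.totalDegree ≤ f.totalDegree ∧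
      (∀ i, g.degreeOf i < (S i).card) ∧ ∀ x ∈ Fintype.piFinset S, eval x g = eval x f := by
  let v : σ → Polynomial R := fun i => ∏ a ∈ S i, (Polynomial.X - Polynomial.C a)
  have hv : ∀ i, (v i).Monic := fun i => Polynomial.monic_prod_X_sub_C _ _
  have hvdeg : ∀ i, (v i).natDegree = (S i).card := fun i => natDegree_prod_X_sub_C (S i)
  let r : σ → ℕ → Polynomial R := fun i m => Polynomial.X ^ m %ₘ v i
  have hr1 : ∀ i m, (r i m).natDegree < (S i).card := fun i m => by
    rw [← hvdeg]
    refine Polynomial.natDegree_modByMonic_lt _ (hv i) fun h => ?_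
    have := hvdeg i
    rw [h, Polynomial.natDegree_one] at this
    exact (Finset.card_pos.2 (hS i)).ne this
  have hr2 : ∀ i m, (r i m).natDegree ≤ m := fun i m => by
    refine (Polynomial.natDegree_modByMonic_le_left).trans_eq (Polynomial.natDegree_X_pow m)
  have hr3 : ∀ i m, ∀ y ∈ S i, (r i m).eval y = y ^ m := fun i m y hy => by
    have hy0 : (v i).eval y = 0 := by
      rw [Polynomial.eval_prod]
      exact Finset.prod_eq_zero hy (by simp)
    have := congrArg (Polynomial.eval y) (Polynomial.modByMonic_add_div (Polynomial.X ^ m) (v i))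
    simpa [hy0] using this
  refine ⟨∑ m ∈ f.support, C (f.coeff m) * ∏ i, Polynomial.aeval (X i) (r i (m i)), ?_, ?_, ?_⟩
  · refine (totalDegree_finsetSum _ _).trans (Finset.sup_le fun m hm => ?_)
    refine (totalDegree_mul _ _).trans ?_
    rw [totalDegree_C, zero_add]
    refine (totalDegree_finsetProd _ _).trans ?_
    refine le_trans ?_ (le_totalDegree hm)
    rw [Finsupp.sum_fintype _ _ fun _ => rfl]
    exact Finset.sum_le_sum fun i _ => (totalDegree_aeval_X_le _ _).trans (hr2 _ _)
  · intro j
    refine (degreeOf_sum_le _ _ _).trans_lt ?_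
    refine (Finset.sup_lt_iff (Finset.card_pos.2 (hS j))).2 fun m _ => ?_
    refine (degreeOf_C_mul_le _ _ _).trans_lt ?_
    refine (degreeOf_prod_le _ _ _).trans_lt ?_
    refine (Finset.sum_le_sum fun i _ => degreeOf_aeval_X_le i j _).trans_lt ?_
    simpa using hr1 _ _
  · intro x hx
    rw [eval_eq' x f, map_sum]
    refine Finset.sum_congr rfl fun m _ => ?_
    rw [map_mul, eval_C, map_prod]
    congr 1
    refine Finset.prod_congr rfl fun i _ => ?_
    rw [← hr3 i (m i) (x i) (Fintype.mem_piFinset.1 hx i), Polynomial.aeval_def,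
      Polynomial.hom_eval₂, eval_X, ← Polynomial.eval₂_id]
    congr 1
    ext c
    simp

/-- The product of the linear forms `X i - a` over all `i` and all `a ∈ A i`. -/
noncomputable def gridPoly {σ : Type*} [Fintype σ] (A : σ → Finset R) : MvPolynomial σ R :=
  ∏ i, Polynomial.aeval (X i) (∏ a ∈ A i, (Polynomial.X - Polynomial.C a))

theorem totalDegree_gridPoly_le {σ : Type*} [Fintype σ] (A : σ → Finset R) :
    (gridPoly A).totalDegree ≤ ∑ i, (A i).card :=
  (totalDegree_finsetProd _ _).trans <| Finset.sum_le_sum fun _ _ =>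
    (totalDegree_aeval_X_le _ _).trans_eq (natDegree_prod_X_sub_C _)

theorem degreeOf_gridPoly_le {σ : Type*} [Fintype σ] (A : σ → Finset R) (j : σ) :
    (gridPoly A).degreeOf j ≤ (A j).card := by
  classical
  refine (degreeOf_prod_le _ _ _).trans ?_
  refine (Finset.sum_le_sum fun i _ => degreeOf_aeval_X_le i j _).trans ?_
  simp

theorem eval_gridPoly_ne_zero_iff {σ : Type*} [Fintype σ] (A : σ → Finset R) (x : σ → R) :
    eval x (gridPoly A) ≠ 0 ↔ ∀ i, x i ∉ A i := by
  simp [gridPoly, Finset.prod_ne_zero_iff, sub_eq_zero]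

theorem card_eval_gridPoly_ne_zero [DecidableEq R] {σ : Type*} [Fintype σ] [DecidableEq σ]
    (S A : σ → Finset R) (hA : ∀ i, A i ⊆ S i) :
    ((Fintype.piFinset S).filter fun x => eval x (gridPoly A) ≠ 0).card =
      ∏ i, ((S i).card - (A i).card) := by
  have : ((Fintype.piFinset S).filter fun x => eval x (gridPoly A) ≠ 0) =
      Fintype.piFinset fun i => S i \ A i := by
    ext x
    simp [eval_gridPoly_ne_zero_iff, forall_and]
  rw [this, Fintype.card_piFinset]
  exact Finset.prod_congr rfl fun i _ => Finset.card_sdiff_of_subset (hA i)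

/-- The weight of an evaluation vector counts the non-zeros on the grid. -/
theorem hammingNorm_evalX {n : ℕ} (K : Fin n → Set F) (f : MvPolynomial (Fin n) F) :
    hammingNorm (evalX K f) =
      ((Fintype.piFinset fun i => (K i).toFinite.toFinset).filter fun x => eval x f ≠ 0).card := by
  rw [hammingNorm]
  refine Finset.card_bij (fun x _ => x.1) ?_ (fun x _ y _ h => Subtype.ext h) ?_
  · intro x hx
    simpa [evalX] using And.intro x.2 (Finset.mem_filter.1 hx).2
  · intro x hx
    simp only [Finset.mem_filter, Fintype.mem_piFinset, Set.Finite.mem_toFinset] at hx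
    exact ⟨⟨x, hx.1⟩, Finset.mem_filter.2 ⟨Finset.mem_univ _, hx.2⟩, rfl⟩

theorem quasiCode_le_cartCode {E : Type} [Field E] {n : ℕ} (K : Fin n → Set E) (d δ : ℕ) (s : Fin n) :
    quasiCode K d δ s ≤ cartCode K d :=
  Submodule.map_mono fun f hf => (mem_restrictTotalDegree _ _ f).2 hf.1

theorem minDist_eq_of_isLeast {E : Type} [Field E] [DecidableEq E] {ι : Type} [Fintype ι]
    (C : Submodule E (ι → E)) (w : ℕ)
    (hw : ∃ v ∈ C, v ≠ 0 ∧ hammingNorm v = w) (hle : ∀ v ∈ C, v ≠ 0 → w ≤ hammingNorm v) :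
    minDist C = w :=
  IsLeast.csInf_eq ⟨hw, by rintro _ ⟨v, hv, hv0, rfl⟩; exact hle v hv hv0⟩

theorem footprintBound_le_hammingNorm {n : ℕ} (K : Fin n → Set F) (hK : ∀ i, (K i).Nonempty)
    (hmono : Monotone fun i => (K i).ncard) (d : ℕ) (v : cartPoint K → F)
    (hv : v ∈ cartCode K d) (hv0 : v ≠ 0) :
    footprintBound n (fun i => (K i).ncard) d ≤ hammingNorm v := by
  obtain ⟨f, hf, rfl⟩ := hv
  have hcard : (fun i => (K i).ncard) = fun i => (K i).toFinite.toFinset.card :=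
    funext fun i => Set.ncard_eq_toFinset_card _ _
  obtain ⟨g, hg1, hg2, hg3⟩ := exists_reduced (fun i => (K i).toFinite.toFinset)
    (fun i => by simpa using hK i) f
  have hgf : evalX K g = evalX K f := funext fun x => hg3 x.1 (by simpa using x.2)
  rw [← hgf] at hv0 ⊢
  rw [hammingNorm_evalX, hcard]
  refine footprintBound_le_card n _ (hcard ▸ hmono) g (fun h => hv0 (by rw [h, map_zero])) hg2 d ?_
  exact hg1.trans ((mem_restrictTotalDegree _ _ f).1 hf)

/-- Spending the degree on prescribed coordinates gives a codeword that is a product of linear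
forms. -/
theorem exists_mem_quasiCode {n : ℕ} (K : Fin n → Set F) (d δ : ℕ) (s : Fin n) (b : Fin n → ℕ)
    (hb : ∀ i, b i ≤ (K i).ncard) (hbd : ∑ i, b i ≤ d) (hbs : b s ≤ (K s).ncard - δ) :
    ∃ v ∈ quasiCode K d δ s, hammingNorm v = ∏ i, ((K i).ncard - b i) := by
  have hcard : ∀ i, (K i).ncard = (K i).toFinite.toFinset.card :=
    fun i => Set.ncard_eq_toFinset_card _ _
  have hA : ∀ i, ∃ A ⊆ (K i).toFinite.toFinset, A.card = b i := fun i =>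
    Finset.exists_subset_card_eq (hcard i ▸ hb i)
  choose A hAS hAc using hA
  refine ⟨evalX K (gridPoly A), ⟨gridPoly A, ⟨?_, ?_⟩, rfl⟩, ?_⟩
  · exact (totalDegree_gridPoly_le A).trans (by simpa [hAc] using hbd)
  · exact (degreeOf_gridPoly_le A s).trans (by rwa [hAc])
  · rw [hammingNorm_evalX, card_eval_gridPoly_ne_zero _ _ hAS]
    simp [hAc, hcard]

/-- with 2 ≤ d_1 ≤ ⋯ ≤ d_n, d = ∑_{i=1}^k (d_i - 1) + ℓ, 0 < ℓ ≤ d_{k+1} - 1,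
if k + 2 ≤ n and d_{k+2} ≤ d_s then
W¹(D_X^{(δ,s)}(d)) = W¹(C_X(d)) = (d_{k+1} - ℓ) ∏_{i=k+2}^n d_i.
(Indices are 0-based: d_{k+1} is the card of K ⟨k⟩, and ∏_{i=k+2}^n runs over indices ≥ k+1.) -/
theorem minDist_quasiCode_case_i
    (n : ℕ) (hn : 2 ≤ n) (K : Fin n → Set F) (hK : ∀ i, 2 ≤ (K i).ncard)
    (hmono : Monotone fun i => (K i).ncard)
    (δ : ℕ) (hδ : 2 ≤ δ) (s : Fin n) (hδs : δ ≤ (K s).ncard)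
    (d k ℓ : ℕ) (hk : k < n)
    (hd : d = (∑ i ∈ Finset.univ.filter (fun i : Fin n => (i : ℕ) < k), ((K i).ncard - 1)) + ℓ)
    (hℓ1 : 0 < ℓ) (hℓ2 : ℓ ≤ (K ⟨k, hk⟩).ncard - 1)
    (hk2 : k + 1 < n) (hds : (K ⟨k + 1, hk2⟩).ncard ≤ (K s).ncard) :
    minDist (quasiCode K d δ s) = minDist (cartCode K d) ∧
    minDist (cartCode K d) =
      ((K ⟨k, hk⟩).ncard - ℓ) *
        ∏ i ∈ Finset.univ.filter (fun i : Fin n => k + 1 ≤ (i : ℕ)), (K i).ncard := by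
  have hBpos : 0 < ((K ⟨k, hk⟩).ncard - ℓ) *
      ∏ i ∈ Finset.univ.filter (fun i : Fin n => k + 1 ≤ (i : ℕ)), (K i).ncard := by
    have := hK ⟨k, hk⟩
    refine Nat.mul_pos (by omega) (Finset.prod_pos fun i _ => ?_)
    have := hK i
    omega
  have hlow : ∀ v ∈ cartCode K d, v ≠ 0 → ((K ⟨k, hk⟩).ncard - ℓ) *
      ∏ i ∈ Finset.univ.filter (fun i : Fin n => k + 1 ≤ (i : ℕ)), (K i).ncard
        ≤ hammingNorm v := by
    intro v hv hv0
    rw [← footprintBound_eq n _ hK k ℓ hk hℓ1 hℓ2, ← hd]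
    refine footprintBound_le_hammingNorm K (fun i => ?_) hmono d v hv hv0
    exact Set.nonempty_of_ncard_ne_zero (by have := hK i; omega)
  obtain ⟨τ, hτ, hτs⟩ : ∃ τ : Equiv.Perm (Fin n),
      (∀ i, (K (τ i)).ncard = (K i).ncard) ∧ k < (τ.symm s : ℕ) := by
    by_cases hs : k < (s : ℕ)
    · exact ⟨1, fun _ => rfl, hs⟩
    · refine ⟨Equiv.swap s ⟨k + 1, hk2⟩, fun i => ?_, by simp⟩
      have heq : (K s).ncard = (K ⟨k + 1, hk2⟩).ncard :=
        le_antisymm (hmono (Fin.le_def.2 (by simp; omega))) hds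
      rw [Equiv.swap_apply_def]
      split_ifs with h1 h2
      · rw [h1, heq]
      · rw [h2, heq]
      · rfl
  let c : Fin n → ℕ := fun i =>
    if (i : ℕ) < k then (K i).ncard - 1 else if i = ⟨k, hk⟩ then ℓ else 0
  have hc : ∀ i, c i ≤ (K i).ncard := fun i => by
    dsimp only [c]
    split_ifs with h1 h2
    · omega
    · subst h2; omega
    · omega
  have hcsum : ∑ i, c i = d := by
    rw [hd, Finset.sum_filter, ← Fintype.sum_ite_eq' (⟨k, hk⟩ : Fin n) fun _ => ℓ,
      ← Finset.sum_add_distrib]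
    refine Finset.sum_congr rfl fun i _ => ?_
    dsimp only [c]
    split_ifs with h1 h2 <;> simp_all
  have hcprod : ∏ i, ((K i).ncard - c i) = ((K ⟨k, hk⟩).ncard - ℓ) *
      ∏ i ∈ Finset.univ.filter (fun i : Fin n => k + 1 ≤ (i : ℕ)), (K i).ncard := by
    rw [Finset.prod_filter,
      ← Fintype.prod_ite_eq' (⟨k, hk⟩ : Fin n) fun i => (K i).ncard - ℓ,
      ← Finset.prod_mul_distrib]
    refine Finset.prod_congr rfl fun i _ => ?_
    have := hK i
    simp only [c, Fin.ext_iff]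
    split_ifs <;> omega
  obtain ⟨v, hv, hvw⟩ := exists_mem_quasiCode K d δ s (fun i => c (τ.symm i))
    (fun i => (hc _).trans_eq (by rw [← hτ, Equiv.apply_symm_apply]))
    ((Equiv.sum_comp τ.symm c).trans hcsum).le
    (by
      have h1 : ¬ (τ.symm s : ℕ) < k := by omega
      have h2 : τ.symm s ≠ ⟨k, hk⟩ := fun h => by rw [h] at hτs; simp at hτs
      simp [c, h1, h2])
  rw [← Equiv.prod_comp τ] at hvw
  simp only [hτ, Equiv.symm_apply_apply] at hvw
  rw [hcprod] at hvw
  have hv0 : v ≠ 0 := by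
    rintro rfl
    rw [hammingNorm_zero] at hvw
    omega
  have hcart := minDist_eq_of_isLeast (cartCode K d) _
    ⟨v, quasiCode_le_cartCode K d δ s hv, hv0, hvw⟩ hlow
  have hquasi := minDist_eq_of_isLeast (quasiCode K d δ s) _ ⟨v, hv, hv0, hvw⟩
    fun u hu => hlow u (quasiCode_le_cartCode K d δ s hu)
  exact ⟨hquasi.trans hcart.symm, hcart⟩

end
end QACC
end

section
/- Assume 2 ≤ d_1 ≤ d_2 ≤ ⋯ ≤ d_n and let d̃ := ∑_{i ≠ s}(d_i − 1) + d_s − δ. If d_s = d_n and 1 ≤ d ≤ d̃, then W^(1)(D_X^{(δ,s)}(d)) = W^(1)(C_X(d)). -/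
namespace QACC

open MvPolynomial

noncomputable section

variable {F : Type} [Field F] [Fintype F] [DecidableEq F]

section AlonFuredi

theorem totalDegree_aeval_le {σ τ R : Type*} [CommRing R] {g : σ → MvPolynomial τ R}
    (hg : ∀ i, (g i).totalDegree ≤ 1) (f : MvPolynomial σ R) :
    (aeval g f).totalDegree ≤ f.totalDegree := by
  rw [aeval_def, eval₂_eq]
  refine totalDegree_finsetSum_le fun m hm => ?_
  refine (totalDegree_mul _ _).trans ?_
  rw [algebraMap_eq, totalDegree_C, zero_add]
  refine (totalDegree_finsetProd _ _).trans (le_trans ?_ (le_totalDegree hm))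
  refine Finset.sum_le_sum fun i _ => (totalDegree_pow _ _).trans ?_
  simpa using Nat.mul_le_mul_left (m i) (hg i)

theorem X_sub_C_dvd_sub_aeval_update {σ R : Type*} [DecidableEq σ] [CommRing R]
    (i : σ) (a : R) (f : MvPolynomial σ R) :
    (X i - C a : MvPolynomial σ R) ∣ f - aeval (Function.update X i (C a)) f := by
  induction f using MvPolynomial.induction_on with
  | C r => simp [algebraMap_eq]
  | add p q hp hq =>
    rw [map_add, add_sub_add_comm]
    exact dvd_add hp hq
  | mul_X p j hp =>
    rw [map_mul, aeval_X]
    have h : (X i - C a : MvPolynomial σ R) ∣ X j - Function.update X i (C a) j := by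
      by_cases hj : j = i
      · subst hj; simp
      · simp [hj]
    have := dvd_add (hp.mul_right (X j))
      (h.mul_left (aeval (Function.update X i (C a)) p))
    convert this using 1
    ring

theorem eval_aeval_update {σ R : Type*} [DecidableEq σ] [CommRing R]
    (i : σ) (a : R) (f : MvPolynomial σ R) (x : σ → R) :
    eval x (aeval (Function.update X i (C a)) f) = eval (Function.update x i a) f := by
  induction f using MvPolynomial.induction_on with
  | C r => simp [algebraMap_eq]
  | add p q hp hq => rw [map_add, map_add, hp, hq, map_add]
  | mul_X p j hp =>
    rw [map_mul, map_mul, hp, aeval_X, map_mul, eval_X]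
    by_cases hj : j = i
    · subst hj; simp
    · simp [hj]

theorem totalDegree_X_sub_C_mul {σ R : Type*} [Field R] (i : σ) (a : R)
    {q : MvPolynomial σ R} (hq : q ≠ 0) :
    ((X i - C a) * q).totalDegree = q.totalDegree + 1 := by
  have h1 : 1 ≤ (X i - C a : MvPolynomial σ R).totalDegree := by
    have h := totalDegree_add (X i - C a : MvPolynomial σ R) (C a)
    rw [sub_add_cancel, totalDegree_X, totalDegree_C] at h
    omega
  have h2 : (X i - C a : MvPolynomial σ R).totalDegree ≤ 1 := by
    simpa using totalDegree_sub_C_le (X i : MvPolynomial σ R) a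
  have h0 : (X i - C a : MvPolynomial σ R) ≠ 0 := by
    intro h; rw [h] at h1; simp at h1
  rw [totalDegree_mul_of_isDomain h0 hq]
  omega

/-- Dividing `f` by `X i - a` gives a quotient `q` of smaller degree such that `f` and
`(X i - a) * q` agree at each point whose projection to `x i = a` is a zero of `f`. -/
theorem exists_eval_eq_sub_mul {σ R : Type*} [DecidableEq σ] [Field R]
    (i : σ) (a : R) (f : MvPolynomial σ R) :
    ∃ q : MvPolynomial σ R, (q ≠ 0 → q.totalDegree + 1 ≤ f.totalDegree) ∧
      ∀ x, eval (Function.update x i a) f = 0 → eval x f = (x i - a) * eval x q := by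
  obtain ⟨q, hq⟩ := X_sub_C_dvd_sub_aeval_update i a f
  refine ⟨q, fun h0 => ?_, fun x hx => ?_⟩
  · rw [← totalDegree_X_sub_C_mul i a h0, ← hq]
    refine (totalDegree_sub _ _).trans (max_le le_rfl (totalDegree_aeval_le (fun j => ?_) f))
    by_cases hj : j = i
    · subst hj; simp
    · simp [hj]
  · have := congrArg (eval x) hq
    rw [map_sub, eval_aeval_update, hx, sub_zero] at this
    simpa using this

theorem forall_mem_update_singleton {σ R : Type*} [DecidableEq σ]
    {A : σ → Finset R} {i : σ} {a : R} (ha : a ∈ A i)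
    {x : σ → R} : (∀ j, x j ∈ Function.update A i {a} j) ↔ (∀ j, x j ∈ A j) ∧ x i = a := by
  constructor
  · intro h
    have hi : x i = a := by simpa using h i
    refine ⟨fun j => ?_, hi⟩
    by_cases hj : j = i
    · subst hj; rwa [hi]
    · simpa [hj] using h j
  · rintro ⟨h, hi⟩ j
    by_cases hj : j = i
    · subst hj; simp [hi]
    · simpa [hj] using h j

theorem sum_update_lt {σ R : Type*} [Fintype σ] [DecidableEq σ]
    {A : σ → Finset R} {i : σ} {B : Finset R} (h : B.card < (A i).card) :
    ∑ j, (Function.update A i B j).card < ∑ j, (A j).card := by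
  refine Finset.sum_lt_sum (fun j _ => ?_) ⟨i, Finset.mem_univ i, by simpa using h⟩
  by_cases hj : j = i
  · subst hj; simpa using h.le
  · simp [hj]

variable {σ R : Type*} [Fintype σ] [DecidableEq σ] [Field R] [DecidableEq R]

/-- The points of a finite grid at which `f` does not vanish. -/
def gridSupport (A : σ → Finset R) (f : MvPolynomial σ R) : Finset (σ → R) :=
  (Fintype.piFinset A).filter fun x => eval x f ≠ 0

theorem mem_gridSupport {A : σ → Finset R} {f : MvPolynomial σ R} {x : σ → R} :
    x ∈ gridSupport A f ↔ (∀ i, x i ∈ A i) ∧ eval x f ≠ 0 := by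
  simp [gridSupport]

theorem card_gridSupport_eq_sum (A : σ → Finset R) (f : MvPolynomial σ R) (i : σ) :
    (gridSupport A f).card =
      ∑ a ∈ A i, (gridSupport (Function.update A i {a}) f).card := by
  rw [Finset.card_eq_sum_card_fiberwise (f := fun x => x i) (t := A i)]
  · refine Finset.sum_congr rfl fun a ha => congrArg Finset.card ?_
    ext x
    rw [Finset.mem_filter, mem_gridSupport, mem_gridSupport, forall_mem_update_singleton ha]
    tauto
  · intro x hx
    exact (mem_gridSupport.1 hx).1 i

/-- The Alon–Füredi theorem: the number of nonzeros of `f` on a finite grid is at least the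
product of some `y i`, `1 ≤ y i ≤ |A i|`, with `∑ (|A i| - y i) ≤ deg f`. -/
theorem exists_prod_le_card_gridSupport (A : σ → Finset R) (f : MvPolynomial σ R)
    (hf : (gridSupport A f).Nonempty) :
    ∃ y : σ → ℕ, (∀ i, 1 ≤ y i ∧ y i ≤ (A i).card) ∧
      ∑ i, ((A i).card - y i) ≤ f.totalDegree ∧ ∏ i, y i ≤ (gridSupport A f).card := by
  induction hN : ∑ i, (A i).card using Nat.strong_induction_on generalizing A f with
  | _ N ih =>
  subst hN
  obtain ⟨x₀, hx₀⟩ := hf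
  have hA : ∀ i, 1 ≤ (A i).card := fun i =>
    Finset.card_pos.2 ⟨x₀ i, (mem_gridSupport.1 hx₀).1 i⟩
  by_cases hone : ∀ i, (A i).card = 1
  · refine ⟨fun _ => 1, fun i => ⟨le_rfl, hA i⟩, by simp [hone], ?_⟩
    simpa using Finset.card_pos.2 ⟨x₀, hx₀⟩
  push Not at hone
  obtain ⟨i, hi⟩ := hone
  have hi2 : 1 < (A i).card := lt_of_le_of_ne (hA i) (Ne.symm hi)
  by_cases hall : ∀ a ∈ A i, (gridSupport (Function.update A i {a}) f).Nonempty
  · obtain ⟨a, ha, hmin⟩ := Finset.exists_min_image (A i)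
      (fun a => (gridSupport (Function.update A i {a}) f).card) (Finset.card_pos.1 (hA i))
    obtain ⟨y, hy, hsum, hprod⟩ := ih _ (sum_update_lt (by simpa using hi2))
      (Function.update A i {a}) f (hall a ha) rfl
    have hyi : y i = 1 := by have := hy i; simp at this; omega
    refine ⟨Function.update y i (A i).card, fun j => ?_, ?_, ?_⟩
    · by_cases hj : j = i
      · subst hj; simpa using hA j
      · simpa [hj] using hy j
    · refine le_trans (Finset.sum_le_sum fun j _ => ?_) hsum
      by_cases hj : j = i
      · subst hj; simp
      · simp [hj]
    · rw [card_gridSupport_eq_sum A f i]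
      refine le_trans ?_ (Finset.card_nsmul_le_sum _ _ _ hmin)
      rw [Finset.prod_update_of_mem (Finset.mem_univ i), smul_eq_mul]
      refine Nat.mul_le_mul_left _ (le_trans (le_of_eq ?_) hprod)
      rw [← Finset.erase_eq, ← Finset.mul_prod_erase _ _ (Finset.mem_univ i), hyi, one_mul]
  · push Not at hall
    obtain ⟨a, ha, hempty⟩ := hall
    obtain ⟨q, hqdeg, hq⟩ := exists_eval_eq_sub_mul i a f
    have hq' : ∀ x, (∀ j, x j ∈ A j) → eval x f = (x i - a) * eval x q := by
      intro x hx
      refine hq x ?_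
      by_contra hne
      refine Finset.notMem_empty (Function.update x i a) (hempty ▸ mem_gridSupport.2 ⟨?_, hne⟩)
      rw [forall_mem_update_singleton ha]
      refine ⟨fun j => ?_, by simp⟩
      by_cases hj : j = i
      · subst hj; simpa using ha
      · simpa [hj] using hx j
    have hsupp : gridSupport (Function.update A i ((A i).erase a)) q = gridSupport A f := by
      ext x
      rw [mem_gridSupport, mem_gridSupport]
      constructor
      · rintro ⟨hx, hne⟩
        have hxi : x i ≠ a ∧ x i ∈ A i := by simpa using hx i
        have hxA : ∀ j, x j ∈ A j := fun j => by
          by_cases hj : j = i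
          · subst hj; exact hxi.2
          · simpa [hj] using hx j
        refine ⟨hxA, ?_⟩
        rw [hq' x hxA]
        exact mul_ne_zero (sub_ne_zero.2 hxi.1) hne
      · rintro ⟨hx, hne⟩
        rw [hq' x hx] at hne
        refine ⟨fun j => ?_, right_ne_zero_of_mul hne⟩
        by_cases hj : j = i
        · subst hj
          simpa using ⟨sub_ne_zero.1 (left_ne_zero_of_mul hne), hx j⟩
        · simpa [hj] using hx j
    have hcard : ((A i).erase a).card + 1 = (A i).card := Finset.card_erase_add_one ha
    have hq0 : q ≠ 0 := by
      rintro rfl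
      rw [← hsupp, mem_gridSupport] at hx₀
      simp at hx₀
    obtain ⟨y, hy, hsum, hprod⟩ := ih _ (sum_update_lt (by omega))
      (Function.update A i ((A i).erase a)) q (hsupp ▸ ⟨x₀, hx₀⟩) rfl
    refine ⟨y, fun j => ⟨(hy j).1, (hy j).2.trans ?_⟩, ?_, hsupp ▸ hprod⟩
    · by_cases hj : j = i
      · subst hj; simp only [Function.update_self]; omega
      · simp [hj]
    · refine le_trans ?_ (hqdeg hq0)
      refine le_trans ?_ (Nat.add_le_add_right hsum 1)
      rw [← Finset.add_sum_erase _ _ (Finset.mem_univ i),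
        ← Finset.add_sum_erase (Finset.univ) (fun j => (Function.update A i _ j).card - y j)
          (Finset.mem_univ i)]
      have hrest : ∑ j ∈ Finset.univ.erase i,
          ((Function.update A i ((A i).erase a) j).card - y j) =
          ∑ j ∈ Finset.univ.erase i, ((A j).card - y j) :=
        Finset.sum_congr rfl fun j hj => by simp [Finset.ne_of_mem_erase hj]
      rw [hrest]
      simp only [Function.update_self]
      omega

/-- The values `y` may be rearranged, without increasing their product or decreasing their sum,
so that the value at an index `s` of largest capacity is at least `δ`. -/
theorem exists_prod_le_of_le_apply {c : σ → ℕ} {s : σ} (hc : ∀ i, c i ≤ c s) {δ d : ℕ}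
    (hδ : δ ≤ c s) (hd : d ≤ ∑ i ∈ Finset.univ.erase s, (c i - 1) + (c s - δ)) (y : σ → ℕ)
    (hy : ∀ i, 1 ≤ y i ∧ y i ≤ c i) (hsum : ∑ i, (c i - y i) ≤ d) :
    ∃ z : σ → ℕ, (∀ i, 1 ≤ z i ∧ z i ≤ c i) ∧ ∑ i, (c i - z i) ≤ d ∧
      ∏ i, z i ≤ ∏ i, y i ∧ δ ≤ z s := by
  induction hk : c s - y s using Nat.strong_induction_on generalizing y with
  | _ k ih =>
  subst hk
  by_cases hs : δ ≤ y s
  · exact ⟨y, hy, hsum, le_rfl, hs⟩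
  have hex : ∃ i, i ≠ s ∧ 2 ≤ y i := by
    by_contra! hcon
    have h1 : ∑ i ∈ Finset.univ.erase s, (c i - y i) =
        ∑ i ∈ Finset.univ.erase s, (c i - 1) :=
      Finset.sum_congr rfl fun i hi => by
        have := hcon i (Finset.ne_of_mem_erase hi)
        have := hy i
        congr 1
        omega
    rw [← Finset.add_sum_erase _ _ (Finset.mem_univ s), h1] at hsum
    omega
  obtain ⟨i, his, hi⟩ := hex
  -- replacing the values at `i` and `s` by `u` and `v` allows induction
  have key : ∀ u v : ℕ, 1 ≤ u → u ≤ c i → y s < v → v ≤ c s → u + v = y i + y s →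
      u * v ≤ y i * y s → ∃ z : σ → ℕ, (∀ i, 1 ≤ z i ∧ z i ≤ c i) ∧ ∑ i, (c i - z i) ≤ d ∧
      ∏ i, z i ≤ ∏ i, y i ∧ δ ≤ z s := by
    intro u v hu hui hv hvs huv hmul
    have hmem : i ∈ Finset.univ.erase s := Finset.mem_erase.2 ⟨his, Finset.mem_univ i⟩
    set z : σ → ℕ := Function.update (Function.update y i u) s v with hz
    have hzs : z s = v := by simp [hz]
    have hzi : z i = u := by simp [hz, his]
    have hzo : ∀ j ∈ (Finset.univ.erase s).erase i, z j = y j := by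
      intro j hj
      rw [Finset.mem_erase, Finset.mem_erase] at hj
      simp [hz, hj.1, hj.2.1]
    obtain ⟨w, hw1, hw2, hw3, hw4⟩ := ih (c s - z s) (by have := hy s; omega) z
      (fun j => by
        by_cases hj : j = s
        · subst hj; have := hy j; omega
        · by_cases hji : j = i
          · subst hji; omega
          · rw [hzo j (by simp [hj, hji])]; exact hy j)
      (le_trans (le_of_eq (by
        rw [← Finset.add_sum_erase _ _ (Finset.mem_univ s), ← Finset.add_sum_erase _ _ hmem,
          ← Finset.add_sum_erase _ (fun j => c j - y j) (Finset.mem_univ s),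
          ← Finset.add_sum_erase _ (fun j => c j - y j) hmem,
          Finset.sum_congr rfl fun j hj => by rw [hzo j hj], hzs, hzi]
        have := hy i
        have := hy s
        omega)) hsum) rfl
    refine ⟨w, hw1, hw2, hw3.trans ?_, hw4⟩
    rw [← Finset.mul_prod_erase _ _ (Finset.mem_univ s), ← Finset.mul_prod_erase _ _ hmem,
      ← Finset.mul_prod_erase _ y (Finset.mem_univ s), ← Finset.mul_prod_erase _ y hmem,
      Finset.prod_congr rfl hzo, hzs, hzi, ← mul_assoc, ← mul_assoc, mul_comm v, mul_comm (y s)]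
    exact Nat.mul_le_mul_right _ hmul
  have hyi := hy i
  have hys := hy s
  have hci := hc i
  rcases le_or_gt (y i) (y s) with hle | hlt
  · refine key (y i - 1) (y s + 1) (by omega) (by omega) (by omega) (by omega) (by omega) ?_
    obtain ⟨t, ht⟩ : ∃ t, y i = t + 1 := ⟨y i - 1, by omega⟩
    rw [ht] at hle ⊢
    simp only [Nat.add_sub_cancel]
    nlinarith
  · exact key (y s) (y i) (by omega) (by omega) hlt (by omega) (by omega)
      (by rw [mul_comm])

/-- A product of linear factors `X i - b` attaining the Alon–Füredi bound. -/
theorem exists_card_gridSupport_eq_prod (A : σ → Finset R) (z : σ → ℕ)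
    (hz : ∀ i, z i ≤ (A i).card) :
    ∃ g : MvPolynomial σ R, g.totalDegree ≤ ∑ i, ((A i).card - z i) ∧
      (∀ s, g.degreeOf s ≤ (A s).card - z s) ∧ (gridSupport A g).card = ∏ i, z i := by
  choose B hBA hB using fun i => Finset.exists_subset_card_eq (Nat.sub_le (A i).card (z i))
  refine ⟨∏ i, ∏ b ∈ B i, (X i - C b), ?_, fun s => ?_, ?_⟩
  · refine (totalDegree_finsetProd _ _).trans (Finset.sum_le_sum fun i _ => ?_)
    refine (totalDegree_finsetProd _ _).trans ?_
    rw [← hB i, Finset.card_eq_sum_ones]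
    refine Finset.sum_le_sum fun b _ => ?_
    simpa using totalDegree_sub_C_le (X i : MvPolynomial σ R) b
  · have hdeg : ∀ i b, degreeOf s (X i - C b : MvPolynomial σ R) ≤ if i = s then 1 else 0 := by
      intro i b
      refine (degreeOf_sub_le s _ _).trans ?_
      rw [degreeOf_X, degreeOf_C]
      simp [eq_comm]
    refine (degreeOf_prod_le s _ _).trans ?_
    refine (Finset.sum_le_sum fun i _ => (degreeOf_prod_le s _ _).trans
      (Finset.sum_le_sum fun b _ => hdeg i b)).trans ?_
    simp [hB]
  · have : gridSupport A (∏ i, ∏ b ∈ B i, (X i - C b)) = Fintype.piFinset fun i => A i \ B i := by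
      ext x
      simp only [mem_gridSupport, Fintype.mem_piFinset, Finset.mem_sdiff, map_prod, map_sub,
        eval_X, eval_C, Finset.prod_ne_zero_iff, sub_ne_zero, Finset.mem_univ, true_imp_iff,
        ← forall_and]
      refine forall_congr' fun i => and_congr_right fun _ => ?_
      exact ⟨fun h hx => h _ hx rfl, fun h b hb hxb => h (hxb ▸ hb)⟩
    rw [this, Fintype.card_piFinset]
    refine Finset.prod_congr rfl fun i _ => ?_
    rw [Finset.card_sdiff_of_subset (hBA i), hB i]
    have := hz i
    omega

end AlonFuredi

theorem hammingNorm_evalX_s12 {n : ℕ} (K : Fin n → Set F) (A : Fin n → Finset F)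
    (hA : ∀ i a, a ∈ A i ↔ a ∈ K i) (f : MvPolynomial (Fin n) F) :
    hammingNorm (evalX K f) = (gridSupport A f).card := by
  rw [hammingNorm]
  refine Finset.card_bij (fun x _ => x.1) (fun x hx => ?_) (fun x _ y _ h => Subtype.ext h)
    fun x hx => ?_
  · exact mem_gridSupport.2 ⟨fun i => (hA i _).2 (x.2 i), (Finset.mem_filter.1 hx).2⟩
  · rw [mem_gridSupport] at hx
    exact ⟨⟨x, fun i => (hA i _).1 (hx.1 i)⟩, Finset.mem_filter.2 ⟨Finset.mem_univ _, hx.2⟩, rfl⟩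

/-- Every nonzero word of the larger code is at least as heavy as some nonzero word of the
smaller one, so the minimum distances agree. -/
theorem minDist_eq_of_le_of_forall_exists {ι : Type} [Fintype ι] {C D : Submodule F (ι → F)}
    (hDC : D ≤ C)
    (h : ∀ v ∈ C, v ≠ 0 → ∃ w ∈ D, w ≠ 0 ∧ hammingNorm w ≤ hammingNorm v) :
    minDist D = minDist C := by
  rcases Set.eq_empty_or_nonempty {w | ∃ v ∈ C, v ≠ 0 ∧ hammingNorm v = w} with he | hne
  · have hD : {w | ∃ v ∈ D, v ≠ 0 ∧ hammingNorm v = w} = ∅ :=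
      Set.subset_eq_empty (fun _ hw => hw.imp fun _ hv => ⟨hDC hv.1, hv.2⟩) he
    rw [minDist, minDist, he, hD]
  · obtain ⟨v, hv, hv0, hvw⟩ := Nat.sInf_mem hne
    obtain ⟨w, hw, hw0, hwv⟩ := h v hv hv0
    refine le_antisymm ?_ (Nat.sInf_le ?_)
    · have hmin : minDist D ≤ hammingNorm w := Nat.sInf_le ⟨w, hw, hw0, rfl⟩
      exact hmin.trans (hwv.trans hvw.le)
    · obtain ⟨u, hu, hu0, huw⟩ := Nat.sInf_mem
        (s := {k | ∃ v ∈ D, v ≠ 0 ∧ hammingNorm v = k}) ⟨_, w, hw, hw0, rfl⟩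
      exact ⟨u, hDC hu, hu0, huw⟩

/-- if d_s = d_n and 1 ≤ d ≤ d̃ then
W¹(D_X^{(δ,s)}(d)) = W¹(C_X(d)). -/
theorem minDist_quasiCode_eq_of_ds_eq_dn
    (n : ℕ) (hn : 2 ≤ n) (K : Fin n → Set F) (hK : ∀ i, 2 ≤ (K i).ncard)
    (hmono : Monotone fun i => (K i).ncard)
    (δ : ℕ) (hδ : 2 ≤ δ) (s : Fin n) (hδs : δ ≤ (K s).ncard)
    (hsn : (K s).ncard = (K ⟨n - 1, by omega⟩).ncard)
    (d : ℕ) (hd1 : 1 ≤ d)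
    (hd2 : d ≤ (∑ i ∈ Finset.univ.erase s, ((K i).ncard - 1)) + ((K s).ncard - δ)) :
    minDist (quasiCode K d δ s) = minDist (cartCode K d) := by
  classical
  refine minDist_eq_of_le_of_forall_exists (Submodule.map_mono fun _ hf =>
    (mem_restrictTotalDegree _ _ _).2 hf.1) ?_
  rintro _ ⟨f, hf, rfl⟩ hf0
  have hfd : f.totalDegree ≤ d := (mem_restrictTotalDegree _ _ _).1 hf
  set A : Fin n → Finset F := fun i => (K i).toFinset with hAdef
  have hA : ∀ i a, a ∈ A i ↔ a ∈ K i := fun i a => by simp [hAdef]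
  have hcard : ∀ i, (A i).card = (K i).ncard := fun i => (Set.ncard_eq_toFinset_card' _).symm
  have hmax : ∀ i, (A i).card ≤ (A s).card := fun i => by
    rw [hcard, hcard, hsn]
    exact hmono (Fin.le_def.2 (Nat.le_sub_one_of_lt i.2))
  have hne : (gridSupport A f).Nonempty := by
    rw [← Finset.card_pos, ← hammingNorm_evalX_s12 K A hA]
    exact hammingNorm_pos_iff.2 hf0
  obtain ⟨y, hy, hysum, hyprod⟩ := exists_prod_le_card_gridSupport A f hne
  obtain ⟨z, hz, hzsum, hzprod, hzs⟩ := exists_prod_le_of_le_apply (δ := δ) hmax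
    (by rwa [hcard]) (by simpa only [hcard] using hd2) y hy (hysum.trans hfd)
  obtain ⟨g, hgdeg, hgs, hgcard⟩ := exists_card_gridSupport_eq_prod A z fun i => (hz i).2
  have hgs' : g.degreeOf s ≤ (K s).ncard - δ :=
    (hgs s).trans (hcard s ▸ Nat.sub_le_sub_left hzs _)
  refine ⟨evalX K g, ⟨g, ⟨hgdeg.trans hzsum, hgs'⟩, rfl⟩, ?_, ?_⟩
  · rw [← hammingNorm_pos_iff, hammingNorm_evalX_s12 K A hA, hgcard]
    exact Finset.prod_pos fun i _ => (hz i).1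
  · rw [hammingNorm_evalX_s12 K A hA, hammingNorm_evalX_s12 K A hA, hgcard]
    exact hzprod.trans hyprod

end
end QACC
end
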